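/- arXiv:2205.11054 — 2 statements merged into one kernel-verified Lean document; each statement's English description precedes it below -/
import Mathlib

section
/- Let (T, F) be a pretorsion theory in a lextensive category C. The following conditions are equivalent: (i) Z = T ∩ F is closed under complemented subobjects, i.e. if X + Y ∈ Z then X, Y ∈ Z; (ii) the ideal of Z-trivial morphisms is stable under pullback along coproduct coprojections, i.e. in every pullback square with bottom edge a coproduct coprojection β : B ↪ Y and right edge g : X → Y, if g is Z-trivial then the pulled-back morphism W → B is Z-trivial; (iii) whenever a composite β∘g is Z-trivial with β a coproduct coprojection, the morphism g is Z-trivial. -/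
/- Basic notions of pretorsion theories, after Borceux, Campanini, Gran,
"Pretorsion theories in lextensive categories". -/

namespace PretorsionPaper

open CategoryTheory CategoryTheory.Limits

universe w₂ w₁ v' u' v u

variable {C : Type u} [Category.{v} C]

/-- A morphism is `Z`-trivial if it factors through an object of `Z`. -/
def IsTrivial (Z : Set C) {X Y : C} (f : X ⟶ Y) : Prop :=
  ∃ (W : C) (g : X ⟶ W) (h : W ⟶ Y), W ∈ Z ∧ g ≫ h = f

/-- `ε : K ⟶ A` is a `Z`-kernel of `f : A ⟶ B`. -/
structure IsZKernel (Z : Set C) {K A B : C} (ε : K ⟶ A) (f : A ⟶ B) : Prop where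
  comp_trivial : IsTrivial Z (ε ≫ f)
  lift : ∀ {Y : C} (l : Y ⟶ A), IsTrivial Z (l ≫ f) → ∃! l' : Y ⟶ K, l' ≫ ε = l

/-- `q : B ⟶ Q` is a `Z`-cokernel of `f : A ⟶ B`. -/
structure IsZCokernel (Z : Set C) {A B Q : C} (q : B ⟶ Q) (f : A ⟶ B) : Prop where
  comp_trivial : IsTrivial Z (f ≫ q)
  desc : ∀ {W : C} (h : B ⟶ W), IsTrivial Z (f ≫ h) → ∃! h' : Q ⟶ W, q ≫ h' = h

/-- A pretorsion theory `(T, F)` in a category `C`: two replete full subcategories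
(given by their classes of objects) such that every morphism from `T` to `F` is
`Z`-trivial (`Z := T ∩ F`) and every object fits in a short `Z`-exact sequence
`T₀ ⟶ X ⟶ F₀` with `T₀ ∈ T`, `F₀ ∈ F`. -/
structure PretorsionTheory (C : Type u) [Category.{v} C] where
  T : Set C
  F : Set C
  replete_T : ∀ {X Y : C}, (X ≅ Y) → X ∈ T → Y ∈ T
  replete_F : ∀ {X Y : C}, (X ≅ Y) → X ∈ F → Y ∈ F
  hom_trivial : ∀ {X Y : C}, X ∈ T → Y ∈ F → ∀ f : X ⟶ Y, IsTrivial (T ∩ F) f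
  exact_seq : ∀ X : C, ∃ (T₀ F₀ : C) (e : T₀ ⟶ X) (h : X ⟶ F₀),
    T₀ ∈ T ∧ F₀ ∈ F ∧ IsZKernel (T ∩ F) e h ∧ IsZCokernel (T ∩ F) h e

/-- The class of trivial objects of a pretorsion theory. -/
def PretorsionTheory.Z (P : PretorsionTheory C) : Set C := P.T ∩ P.F

/-- A morphism `β : B ⟶ Y` is a coproduct coprojection (equivalently, exhibits `B` as a
complemented subobject of `Y`) if there are `B'` and `β' : B' ⟶ Y` making `Y` a
coproduct of `B` and `B'` with coprojections `β`, `β'`. -/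
def IsCoprodInclusion {B Y : C} (β : B ⟶ Y) : Prop :=
  ∃ (B' : C) (β' : B' ⟶ Y), Nonempty (IsColimit (BinaryCofan.mk β β'))

theorem IsTrivial.comp_left {Z : Set C} {X Y W : C} {g : X ⟶ Y} (hg : IsTrivial Z g)
    (f : W ⟶ X) : IsTrivial Z (f ≫ g) := by
  obtain ⟨V, a, b, hV, rfl⟩ := hg
  exact ⟨V, f ≫ a, b, hV, Category.assoc _ _ _⟩

theorem IsTrivial.comp_right {Z : Set C} {X Y W : C} {f : X ⟶ Y} (hf : IsTrivial Z f)
    (g : Y ⟶ W) : IsTrivial Z (f ≫ g) := by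
  obtain ⟨V, a, b, hV, rfl⟩ := hf
  exact ⟨V, a, b ≫ g, hV, (Category.assoc _ _ _).symm⟩

theorem IsZKernel.mono {Z : Set C} {K A B : C} {ε : K ⟶ A} {f : A ⟶ B}
    (h : IsZKernel Z ε f) : Mono ε where
  right_cancellation u v huv := by
    have ht : IsTrivial Z ((u ≫ ε) ≫ f) := by
      simpa using h.comp_trivial.comp_left u
    exact (h.lift (u ≫ ε) ht).unique rfl huv.symm

theorem IsZCokernel.epi {Z : Set C} {A B Q : C} {q : B ⟶ Q} {f : A ⟶ B}
    (h : IsZCokernel Z q f) : Epi q where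
  left_cancellation u v huv := by
    have ht : IsTrivial Z (f ≫ q ≫ u) := by
      simpa using h.comp_trivial.comp_right u
    exact (h.desc (q ≫ u) ht).unique rfl huv.symm

theorem IsZKernel.isIso_of_isTrivial {Z : Set C} {K A B : C} {ε : K ⟶ A} {f : A ⟶ B}
    (h : IsZKernel Z ε f) (hf : IsTrivial Z f) : IsIso ε := by
  obtain ⟨s, hs, -⟩ := h.lift (𝟙 A) (hf.comp_left _)
  have := h.mono
  have : IsSplitEpi ε := ⟨⟨⟨s, hs⟩⟩⟩
  exact isIso_of_mono_of_isSplitEpi ε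

theorem IsZCokernel.isIso_of_isTrivial {Z : Set C} {A B Q : C} {q : B ⟶ Q} {f : A ⟶ B}
    (h : IsZCokernel Z q f) (hf : IsTrivial Z f) : IsIso q := by
  obtain ⟨s, hs, -⟩ := h.desc (𝟙 B) (hf.comp_right _)
  have := h.epi
  have : IsSplitMono q := ⟨⟨⟨s, hs⟩⟩⟩
  exact isIso_of_epi_of_isSplitMono q

namespace PretorsionTheory

theorem mem_Z_of_iso (P : PretorsionTheory C) {X Y : C} (e : X ≅ Y) (hX : X ∈ P.Z) : Y ∈ P.Z :=
  ⟨P.replete_T e hX.1, P.replete_F e hX.2⟩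

theorem mem_Z_of_isTrivial_id (P : PretorsionTheory C) {X : C} (hX : IsTrivial P.Z (𝟙 X)) :
    X ∈ P.Z := by
  obtain ⟨T₀, F₀, e, q, hT, hF, he, hq⟩ := P.exact_seq X
  have : IsIso e := he.isIso_of_isTrivial (by simpa [Z] using hX.comp_right q)
  have : IsIso q := hq.isIso_of_isTrivial (by simpa [Z] using hX.comp_left e)
  exact ⟨P.replete_T (asIso e) hT, P.replete_F (asIso q).symm hF⟩

end PretorsionTheory

theorem isCoprodInclusion_inl [HasBinaryCoproducts C] (X Y : C) :
    IsCoprodInclusion (coprod.inl : X ⟶ X ⨿ Y) :=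
  ⟨Y, coprod.inr, ⟨coprodIsCoprod X Y⟩⟩

theorem isCoprodInclusion_inr [HasBinaryCoproducts C] (X Y : C) :
    IsCoprodInclusion (coprod.inr : Y ⟶ X ⨿ Y) :=
  ⟨X, coprod.inl, ⟨BinaryCofan.isColimitFlip (c := BinaryCofan.mk coprod.inl coprod.inr)
    (coprodIsCoprod X Y)⟩⟩

theorem IsCoprodInclusion.mono [FinitaryExtensive C] {B Y : C} {β : B ⟶ Y}
    (hβ : IsCoprodInclusion β) : Mono β := by
  obtain ⟨_, _, ⟨h⟩⟩ := hβ
  exact FinitaryExtensive.mono_inl_of_isColimit h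

theorem IsCoprodInclusion.of_isPullback [FinitaryExtensive C] [HasPullbacks C] {A B X Y : C}
    {α : A ⟶ X} {f' : A ⟶ B} {f : X ⟶ Y} {β : B ⟶ Y} (sq : IsPullback α f' f β)
    (hβ : IsCoprodInclusion β) : IsCoprodInclusion α := by
  obtain ⟨B', β', ⟨h⟩⟩ := hβ
  exact ⟨pullback f β', pullback.fst f β',
    ((BinaryCofan.isVanKampen_iff _).1 (FinitaryExtensive.vanKampen _ h)
      (BinaryCofan.mk α (pullback.fst f β')) f' (pullback.snd f β') f
      sq.w.symm pullback.condition.symm).2 ⟨sq, IsPullback.of_hasPullback f β'⟩⟩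

theorem IsCoprodInclusion.mem_Z [HasBinaryCoproducts C] (P : PretorsionTheory C)
    (hP : ∀ X Y : C, (X ⨿ Y) ∈ P.Z → X ∈ P.Z ∧ Y ∈ P.Z) {A X : C} {α : A ⟶ X}
    (hα : IsCoprodInclusion α) (hX : X ∈ P.Z) : A ∈ P.Z := by
  obtain ⟨A', _, ⟨h⟩⟩ := hα
  exact (hP A A' (P.mem_Z_of_iso (h.coconePointUniqueUpToIso (colimit.isColimit (pair A A'))) hX)).1

/-- the following are equivalent: (i) `Z` is closed under complemented
subobjects; (ii) `Z`-trivial morphisms are stable under pullbacks along coproduct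
coprojections; (iii) if `g ≫ β` is `Z`-trivial and `β` is a coproduct coprojection,
then `g` is `Z`-trivial. -/
theorem trivial_closed_complemented_subobjects_tfae
    [FinitaryExtensive C] [HasFiniteLimits C] (P : PretorsionTheory C) :
    ((∀ X Y : C, (X ⨿ Y) ∈ P.Z → X ∈ P.Z ∧ Y ∈ P.Z) ↔
      (∀ {W B X Y : C} (tβ : W ⟶ X) (tg : W ⟶ B) (g : X ⟶ Y) (β : B ⟶ Y),
        IsCoprodInclusion β → IsPullback tβ tg g β → IsTrivial P.Z g → IsTrivial P.Z tg)) ∧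
    ((∀ {W B X Y : C} (tβ : W ⟶ X) (tg : W ⟶ B) (g : X ⟶ Y) (β : B ⟶ Y),
        IsCoprodInclusion β → IsPullback tβ tg g β → IsTrivial P.Z g → IsTrivial P.Z tg) ↔
      (∀ {W B Y : C} (g : W ⟶ B) (β : B ⟶ Y),
        IsCoprodInclusion β → IsTrivial P.Z (g ≫ β) → IsTrivial P.Z g)) := by
  have stable_of_closed (hP : ∀ X Y : C, (X ⨿ Y) ∈ P.Z → X ∈ P.Z ∧ Y ∈ P.Z)
      {W B X Y : C} (tβ : W ⟶ X) (tg : W ⟶ B) (g : X ⟶ Y) (β : B ⟶ Y)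
      (hβ : IsCoprodInclusion β) (sq : IsPullback tβ tg g β) (hg : IsTrivial P.Z g) :
      IsTrivial P.Z tg := by
    obtain ⟨V, a, b, hV, rfl⟩ := hg
    have hα := hβ.of_isPullback (IsPullback.of_hasPullback b β)
    exact ⟨pullback b β, pullback.lift (tβ ≫ a) tg (by simpa using sq.w), pullback.snd b β,
      hα.mem_Z P hP hV, pullback.lift_snd _ _ _⟩
  have reflect_of_stable (hP : ∀ {W B X Y : C} (tβ : W ⟶ X) (tg : W ⟶ B) (g : X ⟶ Y)
      (β : B ⟶ Y), IsCoprodInclusion β → IsPullback tβ tg g β → IsTrivial P.Z g →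
        IsTrivial P.Z tg)
      {W B Y : C} (g : W ⟶ B) (β : B ⟶ Y) (hβ : IsCoprodInclusion β)
      (hg : IsTrivial P.Z (g ≫ β)) : IsTrivial P.Z g :=
    have := hβ.mono
    hP (𝟙 W) g (g ≫ β) β hβ (IsPullback.of_horiz_isIso_mono ⟨Category.id_comp _⟩) hg
  have closed_of_reflect (hP : ∀ {W B Y : C} (g : W ⟶ B) (β : B ⟶ Y),
      IsCoprodInclusion β → IsTrivial P.Z (g ≫ β) → IsTrivial P.Z g)
      (X Y : C) (h : (X ⨿ Y) ∈ P.Z) : X ∈ P.Z ∧ Y ∈ P.Z :=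
    ⟨P.mem_Z_of_isTrivial_id (hP (𝟙 X) coprod.inl (isCoprodInclusion_inl X Y)
        ⟨_, coprod.inl, 𝟙 _, h, by simp⟩),
      P.mem_Z_of_isTrivial_id (hP (𝟙 Y) coprod.inr (isCoprodInclusion_inr X Y)
        ⟨_, coprod.inr, 𝟙 _, h, by simp⟩)⟩
  exact ⟨⟨stable_of_closed, fun h => closed_of_reflect (reflect_of_stable h)⟩,
    ⟨reflect_of_stable, fun h => stable_of_closed (closed_of_reflect h)⟩⟩
end PretorsionPaper
end

section
/- Let (T, F) be a pretorsion theory in a lextensive category C. The following conditions are equivalent: (i) Z = T ∩ F is closed under subobjects (for every monomorphism with codomain in Z the domain is in Z); (ii) the ideal of Z-trivial morphisms is stable under pullback along monomorphisms, i.e. in every pullback square with bottom edge a monomorphism m : B → Y and right edge g : X → Y, if g is Z-trivial then the pulled-back morphism W → B is Z-trivial; (iii) whenever a composite m∘g is Z-trivial with m a monomorphism, the morphism g is Z-trivial. -/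
/- Basic notions of pretorsion theories, after Borceux, Campanini, Gran,
"Pretorsion theories in lextensive categories". -/

namespace PretorsionPaper

open CategoryTheory CategoryTheory.Limits

universe w₂ w₁ v' u' v u

variable {C : Type u} [Category.{v} C]

theorem IsTrivial.precomp {Z : Set C} {X Y V : C} {f : X ⟶ Y} (hf : IsTrivial Z f)
    (k : V ⟶ X) : IsTrivial Z (k ≫ f) := by
  obtain ⟨W, a, b, hW, rfl⟩ := hf
  exact ⟨W, k ≫ a, b, hW, Category.assoc _ _ _⟩

theorem IsTrivial.postcomp {Z : Set C} {X Y V : C} {f : X ⟶ Y} (hf : IsTrivial Z f)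
    (k : Y ⟶ V) : IsTrivial Z (f ≫ k) := by
  obtain ⟨W, a, b, hW, rfl⟩ := hf
  exact ⟨W, a, b ≫ k, hW, (Category.assoc _ _ _).symm⟩

/-- A `Z`-kernel of a `Z`-trivial morphism is an isomorphism. -/
theorem IsZKernel.isIso {Z : Set C} {K A B : C} {e : K ⟶ A} {f : A ⟶ B}
    (he : IsZKernel Z e f) (hf : IsTrivial Z f) : IsIso e := by
  obtain ⟨s, hs, -⟩ := he.lift (𝟙 A) (by simpa using hf)
  exact ⟨s, (he.lift e he.comp_trivial).unique (by simp [hs]) (by simp), hs⟩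

/-- A `Z`-cokernel of a `Z`-trivial morphism is an isomorphism. -/
theorem IsZCokernel.isIso {Z : Set C} {A B Q : C} {q : B ⟶ Q} {f : A ⟶ B}
    (hq : IsZCokernel Z q f) (hf : IsTrivial Z f) : IsIso q := by
  obtain ⟨s, hs, -⟩ := hq.desc (𝟙 B) (by simpa using hf)
  refine ⟨s, hs, (hq.desc q hq.comp_trivial).unique ?_ (by simp)⟩
  simp [reassoc_of% hs]

/-- An object whose identity is trivial is itself trivial. -/
theorem PretorsionTheory.mem_Z_of_isTrivial_id_s10 (P : PretorsionTheory C) {N : C}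
    (hN : IsTrivial P.Z (𝟙 N)) : N ∈ P.Z := by
  obtain ⟨T₀, F₀, e, h, hT, hF, he, hh⟩ := P.exact_seq N
  have : IsIso e := he.isIso (by simpa [PretorsionTheory.Z] using hN.postcomp h)
  have : IsIso h := hh.isIso (by simpa [PretorsionTheory.Z] using hN.precomp e)
  exact ⟨P.replete_T (asIso e) hT, P.replete_F (asIso h).symm hF⟩

/-- the following are equivalent: (i) `Z` is closed under subobjects;
(ii) `Z`-trivial morphisms are stable under pullbacks along monomorphisms; (iii) if
`g ≫ m` is `Z`-trivial and `m` is a monomorphism, then `g` is `Z`-trivial. -/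
theorem trivial_closed_subobjects_tfae
    [FinitaryExtensive C] [HasFiniteLimits C] (P : PretorsionTheory C) :
    ((∀ {N X : C} (n : N ⟶ X), Mono n → X ∈ P.Z → N ∈ P.Z) ↔
      (∀ {W B X Y : C} (tm : W ⟶ X) (tg : W ⟶ B) (g : X ⟶ Y) (m : B ⟶ Y),
        Mono m → IsPullback tm tg g m → IsTrivial P.Z g → IsTrivial P.Z tg)) ∧
    ((∀ {W B X Y : C} (tm : W ⟶ X) (tg : W ⟶ B) (g : X ⟶ Y) (m : B ⟶ Y),
        Mono m → IsPullback tm tg g m → IsTrivial P.Z g → IsTrivial P.Z tg) ↔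
      (∀ {W B Y : C} (g : W ⟶ B) (m : B ⟶ Y),
        Mono m → IsTrivial P.Z (g ≫ m) → IsTrivial P.Z g)) := by
  have cancel_of_pullback :
      (∀ {W B X Y : C} (tm : W ⟶ X) (tg : W ⟶ B) (g : X ⟶ Y) (m : B ⟶ Y),
        Mono m → IsPullback tm tg g m → IsTrivial P.Z g → IsTrivial P.Z tg) →
      (∀ {W B Y : C} (g : W ⟶ B) (m : B ⟶ Y),
        Mono m → IsTrivial P.Z (g ≫ m) → IsTrivial P.Z g) := by
    intro H W B Y g m hm hgm
    refine H (𝟙 W) g (g ≫ m) m hm ⟨⟨by simp⟩, ⟨PullbackCone.IsLimit.mk _ (fun s => s.fst)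
      (fun s => by simp) (fun s => ?_) (fun s k hk _ => by simpa using hk)⟩⟩ hgm
    rw [← cancel_mono m, Category.assoc, s.condition]
  have pullback_of_cancel :
      (∀ {W B Y : C} (g : W ⟶ B) (m : B ⟶ Y),
        Mono m → IsTrivial P.Z (g ≫ m) → IsTrivial P.Z g) →
      (∀ {W B X Y : C} (tm : W ⟶ X) (tg : W ⟶ B) (g : X ⟶ Y) (m : B ⟶ Y),
        Mono m → IsPullback tm tg g m → IsTrivial P.Z g → IsTrivial P.Z tg) :=
    fun H _ _ _ _ tm tg _ m hm sq hg => H tg m hm (sq.w ▸ hg.precomp tm)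
  refine ⟨⟨fun H => pullback_of_cancel ?_, fun H N X n hn hX => ?_⟩,
    cancel_of_pullback, pullback_of_cancel⟩
  · rintro W B Y g m hm ⟨V, a, b, hV, hab⟩
    exact ⟨pullback b m, pullback.lift a g hab, pullback.snd b m,
      H (pullback.fst b m) inferInstance hV, pullback.lift_snd _ _ _⟩
  · exact P.mem_Z_of_isTrivial_id_s10
      (cancel_of_pullback H (𝟙 N) n hn ⟨X, n, 𝟙 X, hX, by simp⟩)
end PretorsionPaper
end
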